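/- arXiv:2508.12041 — 2 statements merged into one kernel-verified Lean document; each statement's English description precedes it below -/
import Mathlib

section
/- With notation as in the context (an algebra A over ℚ(q), an element B with its idivided powers B^{(m)}_{p̄} for parameter ς = −q^{−2}, an integer N ≥ 0, and a family (b_m) satisfying the stated recursion and vanishing), the following two identities hold in A for every integer k ≥ 0: (i) b_N · B^{(k)}_{k̄} = Σ_{x=0}^{N} q^{(k−x)(N−x)} · ( Σ_{y=0}^{⌈(N−x)/2⌉} (−1)^y q^{2y(⌈(N−x)/2⌉ − 1 − N + x)} ⌊⌈(N−x)/2⌉ ¦ y⌋_{q²} · B^{(k−x−2y)}_{(k+N) mod 2} ) · b_{N−x}; and (ii) b_N · B^{(k)}_{(k+1) mod 2} = Σ_{x=0}^{N} q^{(k−x)(N−x)} · ( Σ_{y=0}^{⌊(N−x)/2⌋} (−1)^y q^{2y(⌊(N−x)/2⌋ − N + x)} ⌊⌊(N−x)/2⌋ ¦ y⌋_{q²} · B^{(k−x−2y)}_{(k+1+N) mod 2} ) · b_{N−x}. -/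
noncomputable section

namespace SplitIdp

/-- The base field `F = ℚ(q)`. -/
abbrev F : Type := RatFunc ℚ

/-- `q^e` for `e : ℤ`. -/
def qz (e : ℤ) : F := (RatFunc.X : F) ^ e

/-- The quantum integer `[n]`. -/
def qint (n : ℤ) : F := (qz n - qz (-n)) / (qz 1 - qz (-1))

/-- The quantum factorial `[n]!`. -/
def qfact (n : ℕ) : F := ∏ i ∈ Finset.range n, qint ((i : ℤ) + 1)

/-- The balanced Gaussian binomial coefficient in the variable `q²`. -/
def qbinom2 (a : ℤ) (k : ℕ) : F :=
  ∏ s ∈ Finset.range k,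
    (qz (2 * (a - s)) - qz (-(2 * (a - s)))) /
      (qz (2 * ((s : ℤ) + 1)) - qz (-(2 * ((s : ℤ) + 1))))

variable {A : Type*} [Ring A] [Algebra F A]

/-- The idivided powers `B^{(m)}_{p̄}` of an element `B`, with parameter `ς = −q^{−2}`:
`B^{(0)}_{p̄} = 1`; for `m ≥ 1`,
`B^{(m)}_{0̄} = (1/[m]!)·B^{1+δ}·∏_{r=1}^{⌈m/2⌉−1}(B² + q^{−1}[2r]²)` (δ = 1 iff m even), and
`B^{(m)}_{1̄} = (1/[m]!)·B^{ε}·∏_{r=1}^{⌊m/2⌋}(B² + q^{−1}[2r−1]²)` (ε = 1 iff m odd);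
`B^{(m)}_{p̄} = 0` for `m < 0`. -/
def idp (B : A) (p : ZMod 2) (m : ℤ) : A :=
  if m < 0 then 0
  else if m = 0 then 1
  else if p = 0 then
    (qfact m.toNat)⁻¹ •
      (B ^ (if m % 2 = 0 then 2 else 1) *
        ((List.range ((m.toNat + 1) / 2 - 1)).map
            (fun r => B ^ 2 + (qz (-1) * qint (2 * ((r : ℤ) + 1)) ^ 2) • (1 : A))).prod)
  else
    (qfact m.toNat)⁻¹ •
      (B ^ (if m % 2 = 0 then 0 else 1) *
        ((List.range (m.toNat / 2)).map
            (fun r => B ^ 2 + (qz (-1) * qint (2 * ((r : ℤ) + 1) - 1) ^ 2) • (1 : A))).prod)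

end SplitIdp

open SplitIdp
namespace SplitIdp

section Scalars

/-- The numerator `q^n − q^{−n}` of the quantum integer `[n]`. -/
def qnum (n : ℤ) : F := qz n - qz (-n)

lemma qz_zero : qz 0 = 1 := by simp [qz]

lemma qz_add (m n : ℤ) : qz (m + n) = qz m * qz n := zpow_add₀ RatFunc.X_ne_zero m n

lemma qz_neg (n : ℤ) : qz (-n) = (qz n)⁻¹ := zpow_neg _ n

lemma qz_sub (m n : ℤ) : qz (m - n) = qz m * (qz n)⁻¹ := by rw [sub_eq_add_neg, qz_add, qz_neg]

lemma qz_two_mul (n : ℤ) : qz (2 * n) = qz n ^ 2 := by rw [two_mul, qz_add, sq]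

lemma qz_two : qz 2 = qz 1 ^ 2 := qz_two_mul 1

lemma qz_ne_zero (n : ℤ) : qz n ≠ 0 := zpow_ne_zero n RatFunc.X_ne_zero

lemma qz_natCast_ne_one {n : ℕ} (hn : n ≠ 0) : qz n ≠ 1 := by
  intro h
  have h1 : algebraMap (Polynomial ℚ) F (Polynomial.X ^ n) = algebraMap (Polynomial ℚ) F 1 := by
    simpa [qz, RatFunc.algebraMap_X] using h
  have h2 := congrArg Polynomial.natDegree (RatFunc.algebraMap_injective ℚ h1)
  simp at h2
  exact hn h2

lemma qnum_ne_zero {n : ℤ} (hn : 0 < n) : qnum n ≠ 0 := by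
  intro h
  apply qz_natCast_ne_one (n := (2 * n).toNat) (by omega)
  rw [Int.toNat_of_nonneg (by omega), two_mul, qz_add]
  rw [qnum, sub_eq_zero, qz_neg] at h
  nth_rewrite 1 [h]
  exact inv_mul_cancel₀ (qz_ne_zero n)

lemma qint_eq (n : ℤ) : qint n = qnum n / qnum 1 := rfl

lemma qint_ne_zero {n : ℤ} (hn : 0 < n) : qint n ≠ 0 :=
  div_ne_zero (qnum_ne_zero hn) (qnum_ne_zero one_pos)

lemma qint_zero : qint 0 = 0 := by simp [qint]

lemma qint_one : qint 1 = 1 := div_self (qnum_ne_zero one_pos)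

lemma qint_neg (n : ℤ) : qint (-n) = -qint n := by
  simp only [qint, neg_neg]
  ring

lemma qfact_zero : qfact 0 = 1 := by simp [qfact]

lemma qfact_succ (n : ℕ) : qfact (n + 1) = qfact n * qint (n + 1) := Finset.prod_range_succ _ n

lemma qbinom2_succ (a : ℤ) (y : ℕ) :
    qbinom2 a (y + 1) = qbinom2 a y * (qnum (2 * (a - y)) / qnum (2 * ((y : ℤ) + 1))) :=
  Finset.prod_range_succ _ y

lemma qnum_mul_qbinom2 (a : ℤ) (y : ℕ) :
    qnum (2 * (a + 1)) * qbinom2 a y = qnum (2 * (a + 1 - y)) * qbinom2 (a + 1) y := by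
  induction y with
  | zero => simp [qbinom2]
  | succ y ih =>
    rw [qbinom2_succ, qbinom2_succ, ← mul_assoc, ih]
    have : a + 1 - ((y + 1 : ℕ) : ℤ) = a - y := by push_cast; ring
    rw [this]
    ring

lemma qnum_mul_qbinom2_succ (a : ℤ) (y : ℕ) :
    qnum (2 * ((y : ℤ) + 1)) * qbinom2 (a + 1) (y + 1) = qnum (2 * (a + 1)) * qbinom2 a y := by
  have h : qnum (2 * ((y : ℤ) + 1)) ≠ 0 := qnum_ne_zero (by omega)
  rw [qnum_mul_qbinom2, qbinom2_succ]
  field_simp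

lemma qbinom2_eq_zero {a y : ℕ} (h : a < y) : qbinom2 a y = 0 := by
  refine Finset.prod_eq_zero (Finset.mem_range.2 h) ?_
  simp

/-- The Gaussian binomial coefficient in `q²`, extended by zero to negative lower index. -/
def qchoose (a y : ℤ) : F := if y < 0 then 0 else qbinom2 a y.toNat

lemma qchoose_natCast (a : ℤ) (y : ℕ) : qchoose a y = qbinom2 a y := by simp [qchoose]

lemma qchoose_of_neg (a : ℤ) {y : ℤ} (h : y < 0) : qchoose a y = 0 := if_pos h

lemma qnum_mul_qchoose (a y : ℤ) :
    qnum (2 * (a + 1)) * qchoose a y = qnum (2 * (a + 1 - y)) * qchoose (a + 1) y := by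
  rcases lt_or_ge y 0 with h | h
  · simp [qchoose_of_neg _ h]
  · lift y to ℕ using h
    simpa only [qchoose_natCast] using qnum_mul_qbinom2 a y

lemma qnum_mul_qchoose_sub_one (a y : ℤ) :
    qnum (2 * y) * qchoose (a + 1) y = qnum (2 * (a + 1)) * qchoose a (y - 1) := by
  rcases lt_or_ge (y - 1) 0 with h | h
  · rw [qchoose_of_neg a h]
    rcases lt_or_ge y 0 with h' | h'
    · simp [qchoose_of_neg _ h']
    · obtain rfl : y = 0 := by omega
      simp [qnum]
  · obtain ⟨z, rfl⟩ : ∃ z : ℕ, y = z + 1 := ⟨(y - 1).toNat, by omega⟩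
    have := qnum_mul_qbinom2_succ a z
    rw [← qchoose_natCast, ← qchoose_natCast] at this
    simpa using this

/-- The three entries of a Pascal triangle as multiples of one scalar. -/
lemma exists_qchoose_eq {a : ℤ} (ha : 0 ≤ a) (y : ℤ) :
    ∃ t : F, qchoose (a + 1) y = qnum (2 * (a + 1)) * t ∧
      qchoose a y = qnum (2 * (a + 1 - y)) * t ∧ qchoose a (y - 1) = qnum (2 * y) * t := by
  have h : qnum (2 * (a + 1)) ≠ 0 := qnum_ne_zero (by omega)
  refine ⟨qchoose (a + 1) y / qnum (2 * (a + 1)), by field_simp, ?_, ?_⟩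
  · rw [← mul_div_assoc, eq_div_iff h, ← qnum_mul_qchoose, mul_comm]
  · rw [← mul_div_assoc, eq_div_iff h, qnum_mul_qchoose_sub_one, mul_comm]

/-- The coefficient `(−1)^y q^{2ye} ⌊a ¦ y⌋_{q²}`. -/
def signedCoeff (a e y : ℤ) : F := (-1) ^ y * qz (2 * y * e) * qchoose a y

lemma signedCoeff_of_neg (a e : ℤ) {y : ℤ} (h : y < 0) : signedCoeff a e y = 0 := by
  rw [signedCoeff, qchoose_of_neg a h, mul_zero]

lemma neg_one_zpow_sub_one (y : ℤ) : (-1 : F) ^ (y - 1) = -(-1) ^ y := by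
  rw [zpow_sub₀ (by simp), zpow_one, div_neg, div_one]

lemma qz_mul_two (m : ℤ) : qz (m * 2) = qz m ^ 2 := by rw [mul_comm, qz_two_mul]

lemma qz_mul_four (m : ℤ) : qz (m * 4) = qz m ^ 4 := by
  rw [show m * 4 = 2 * (2 * m) by ring, qz_two_mul, qz_two_mul, ← pow_mul]

lemma lowerCoeff_rec_even (k j a y : ℤ) :
    qz (2 * a - k + j) * qz (j * (2 * a)) * (signedCoeff a (a - 2 * a) y * qint (j - 2 * y + 1))
      - qz (2 * a - 2 - k + j) * qint (2 * a) * qz ((j - 1) * (2 * a - 1)) *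
        signedCoeff (a - 1) (a - 1 - (2 * a - 1)) (y - 1)
      + qint (k - j) * qz ((j + 1) * (2 * a + 1)) * signedCoeff a (a - (2 * a + 1)) y
      = qint (k + 1) * qz ((j + 1) * (2 * a)) * signedCoeff a (a - 1 - 2 * a) y := by
  have h := qnum_mul_qchoose_sub_one (a - 1) y
  rw [sub_add_cancel] at h
  simp only [signedCoeff, qint_eq, neg_one_zpow_sub_one, div_eq_mul_inv]
  generalize (qnum 1)⁻¹ = D, (-1 : F) ^ y = s, qchoose a y = c, qchoose (a - 1) (y - 1) = d at *
  linear_combination (norm := skip) -(qz (2 * a - 2 - k + j) * D * qz ((j - 1) * (2 * a - 1)) * s *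
    qz (2 * (y - 1) * (a - 1 - (2 * a - 1)))) * h
  simp only [qnum]
  ring_nf
  simp only [qz_add, qz_sub, qz_neg, qz_mul_two, qz_two]
  have hq := qz_ne_zero 1
  have ha := qz_ne_zero a
  have hk := qz_ne_zero k
  have hj := qz_ne_zero j
  have hy := qz_ne_zero y
  have hja := qz_ne_zero (a * j)
  have hya := qz_ne_zero (a * y)
  field_simp
  ring

lemma lowerCoeff_rec_odd {a : ℤ} (ha : 0 ≤ a) (k j y : ℤ) :
    qz (2 * a + 1 - k + j) * qz (j * (2 * a + 1)) *
      (signedCoeff a (a - (2 * a + 1)) y * qint (j - 2 * y + 1)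
        - signedCoeff a (a - (2 * a + 1)) (y - 1) * (qz (-1) * qint (j - 2 * (y - 1))))
      - qz (2 * a + 1 - 2 - k + j) * qint (2 * a + 1) * qz ((j - 1) * (2 * a + 1 - 1)) *
        signedCoeff a (a - (2 * a + 1 - 1)) (y - 1)
      + qint (k - j) * qz ((j + 1) * (2 * a + 1 + 1)) *
        signedCoeff (a + 1) (a + 1 - (2 * a + 1 + 1)) y
      = qint (k + 1) * qz ((j + 1) * (2 * a + 1)) *
        signedCoeff (a + 1) (a + 1 - 1 - (2 * a + 1)) y := by
  obtain ⟨t, h1, h2, h3⟩ := exists_qchoose_eq ha y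
  simp only [signedCoeff, qint_eq, neg_one_zpow_sub_one, div_eq_mul_inv, h1, h2, h3]
  generalize (qnum 1)⁻¹ = D, (-1 : F) ^ y = s
  simp only [qnum]
  ring_nf
  simp only [qz_add, qz_sub, qz_neg, qz_mul_two, qz_two]
  have hq := qz_ne_zero 1
  have ha := qz_ne_zero a
  have hk := qz_ne_zero k
  have hj := qz_ne_zero j
  have hy := qz_ne_zero y
  have hja := qz_ne_zero (a * j)
  have hya := qz_ne_zero (a * y)
  field_simp
  ring

lemma upperCoeff_rec_even {a : ℤ} (ha : 0 ≤ a) (k j y : ℤ) :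
    qz (2 * a - k + j) * qz (j * (2 * a)) *
      (signedCoeff a (a - 1 - 2 * a) y * qint (j - 2 * y + 1)
        - signedCoeff a (a - 1 - 2 * a) (y - 1) * (qz (-1) * qint (j - 2 * (y - 1))))
      - qz (2 * a - 2 - k + j) * qint (2 * a) * qz ((j - 1) * (2 * a - 1)) *
        signedCoeff a (a - 1 - (2 * a - 1)) (y - 1)
      + qint (k - j) * qz ((j + 1) * (2 * a + 1)) *
        signedCoeff (a + 1) (a + 1 - 1 - (2 * a + 1)) y
      = qint (k + 1) * qz ((j + 1) * (2 * a)) * signedCoeff a (a - 2 * a) y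
        - qz (-1) * qint k * qz ((j - 1) * (2 * a)) * signedCoeff a (a - 2 * a) (y - 1) := by
  obtain ⟨t, h1, h2, h3⟩ := exists_qchoose_eq ha y
  simp only [signedCoeff, qint_eq, neg_one_zpow_sub_one, div_eq_mul_inv, h1, h2, h3]
  generalize (qnum 1)⁻¹ = D, (-1 : F) ^ y = s
  simp only [qnum]
  ring_nf
  simp only [qz_add, qz_sub, qz_neg, qz_mul_two, qz_two]
  have hq := qz_ne_zero 1
  have ha := qz_ne_zero a
  have hk := qz_ne_zero k
  have hj := qz_ne_zero j
  have hy := qz_ne_zero y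
  have hja := qz_ne_zero (a * j)
  have hya := qz_ne_zero (a * y)
  field_simp
  ring

lemma upperCoeff_rec_odd {a : ℤ} (ha : 0 ≤ a) (k j y : ℤ) :
    qz (2 * a + 1 - k + j) * qz (j * (2 * a + 1)) *
      (signedCoeff (a + 1) (a + 1 - 1 - (2 * a + 1)) y * qint (j - 2 * y + 1))
      - qz (2 * a + 1 - 2 - k + j) * qint (2 * a + 1) * qz ((j - 1) * (2 * a + 1 - 1)) *
        signedCoeff a (a - 1 - (2 * a + 1 - 1)) (y - 1)
      + qint (k - j) * qz ((j + 1) * (2 * a + 1 + 1)) *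
        signedCoeff (a + 1) (a + 1 - 1 - (2 * a + 1 + 1)) y
      = qint (k + 1) * qz ((j + 1) * (2 * a + 1)) * signedCoeff a (a - (2 * a + 1)) y
        - qz (-1) * qint k * qz ((j - 1) * (2 * a + 1)) *
          signedCoeff a (a - (2 * a + 1)) (y - 1) := by
  obtain ⟨t, h1, h2, h3⟩ := exists_qchoose_eq ha y
  simp only [signedCoeff, qint_eq, neg_one_zpow_sub_one, div_eq_mul_inv, h1, h2, h3]
  generalize (qnum 1)⁻¹ = D, (-1 : F) ^ y = s
  simp only [qnum]
  ring_nf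
  simp only [qz_add, qz_sub, qz_neg, qz_mul_two, qz_two, qz_mul_four]
  have hq := qz_ne_zero 1
  have ha := qz_ne_zero a
  have hk := qz_ne_zero k
  have hj := qz_ne_zero j
  have hy := qz_ne_zero y
  have hja := qz_ne_zero (a * j)
  have hya := qz_ne_zero (a * y)
  field_simp
  ring

/-- Coefficients of the sum attached to `⌈n/2⌉`. -/
def upperCoeff (n y : ℤ) : F := signedCoeff ((n + 1) / 2) ((n + 1) / 2 - 1 - n) y

/-- Coefficients of the sum attached to `⌊n/2⌋`. -/
def lowerCoeff (n y : ℤ) : F := signedCoeff (n / 2) (n / 2 - n) y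

lemma upperCoeff_neg_one (n : ℤ) : upperCoeff n (-1) = 0 := signedCoeff_of_neg _ _ (by norm_num)

lemma lowerCoeff_neg_one (n : ℤ) : lowerCoeff n (-1) = 0 := signedCoeff_of_neg _ _ (by norm_num)

lemma signedCoeff_zero (a e : ℤ) : signedCoeff a e 0 = 1 := by
  simp [signedCoeff, qchoose, qbinom2, qz_zero]

lemma lowerCoeff_rec {n : ℤ} (hn : 0 ≤ n) (k j y : ℤ) :
    qz (n - k + j) * qz (j * n) *
      (lowerCoeff n y * qint (j - 2 * y + 1)
        - if Odd n then lowerCoeff n (y - 1) * (qz (-1) * qint (j - 2 * (y - 1))) else 0)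
      - qz (n - 2 - k + j) * qint n * qz ((j - 1) * (n - 1)) * lowerCoeff (n - 1) (y - 1)
      + qint (k - j) * qz ((j + 1) * (n + 1)) * lowerCoeff (n + 1) y
      = qint (k + 1) * qz ((j + 1) * n) * upperCoeff n y := by
  simp only [lowerCoeff, upperCoeff]
  obtain ⟨a, rfl | rfl⟩ := Int.even_or_odd' n
  · have h1 : 2 * a / 2 = a := by omega
    have h2 : (2 * a - 1) / 2 = a - 1 := by omega
    have h3 : (2 * a + 1) / 2 = a := by omega
    rw [if_neg (by simp), sub_zero, h1, h2, h3]
    exact lowerCoeff_rec_even k j a y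
  · have h1 : (2 * a + 1) / 2 = a := by omega
    have h2 : (2 * a + 1 - 1) / 2 = a := by omega
    have h3 : (2 * a + 1 + 1) / 2 = a + 1 := by omega
    rw [if_pos (by simp), h1, h2, h3]
    exact lowerCoeff_rec_odd (by omega) k j y

lemma upperCoeff_rec {n : ℤ} (hn : 0 ≤ n) (k j y : ℤ) :
    qz (n - k + j) * qz (j * n) *
      (upperCoeff n y * qint (j - 2 * y + 1)
        - if Even n then upperCoeff n (y - 1) * (qz (-1) * qint (j - 2 * (y - 1))) else 0)
      - qz (n - 2 - k + j) * qint n * qz ((j - 1) * (n - 1)) * upperCoeff (n - 1) (y - 1)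
      + qint (k - j) * qz ((j + 1) * (n + 1)) * upperCoeff (n + 1) y
      = qint (k + 1) * qz ((j + 1) * n) * lowerCoeff n y
        - qz (-1) * qint k * qz ((j - 1) * n) * lowerCoeff n (y - 1) := by
  simp only [lowerCoeff, upperCoeff]
  obtain ⟨a, rfl | rfl⟩ := Int.even_or_odd' n
  · have h1 : 2 * a / 2 = a := by omega
    have h2 : (2 * a - 1 + 1) / 2 = a := by omega
    have h3 : (2 * a + 1) / 2 = a := by omega
    have h4 : (2 * a + 1 + 1) / 2 = a + 1 := by omega
    rw [if_pos (by simp), h1, h2, h3, h4]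
    exact upperCoeff_rec_even (by omega) k j y
  · have h1 : (2 * a + 1) / 2 = a := by omega
    have h2 : (2 * a + 1 - 1 + 1) / 2 = a := by omega
    have h3 : (2 * a + 1 + 1) / 2 = a + 1 := by omega
    have h4 : (2 * a + 1 + 1 + 1) / 2 = a + 1 := by omega
    rw [if_neg (by simp), sub_zero, h1, h2, h3, h4]
    exact upperCoeff_rec_odd (by omega) k j y

end Scalars

section IdividedPowers

variable {A : Type*} [Ring A] [Algebra F A]

/-- The product `∏_{r<t} (B² + q^{−1} c(r)²)`. -/
def idpProd (B : A) (c : ℤ → F) (t : ℕ) : A :=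
  ((List.range t).map (fun r => B ^ 2 + (qz (-1) * c r ^ 2) • (1 : A))).prod

lemma idpProd_succ (B : A) (c : ℤ → F) (t : ℕ) :
    idpProd B c (t + 1) = idpProd B c t * (B ^ 2 + (qz (-1) * c t ^ 2) • (1 : A)) := by
  simp [idpProd, List.range_succ]

lemma commute_idpProd (B : A) (c : ℤ → F) (t : ℕ) : Commute B (idpProd B c t) := by
  induction t with
  | zero => simp [idpProd]
  | succ t ih =>
    rw [idpProd_succ]
    exact ih.mul_right (((Commute.refl B).pow_right 2).add_right
      ((Commute.one_right B).smul_right _))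

lemma idp_of_neg (B : A) (p : ZMod 2) {m : ℤ} (h : m < 0) : idp B p m = 0 := if_pos h

lemma idp_zero (B : A) (p : ZMod 2) : idp B p 0 = 1 := by simp [idp]

lemma idp_even_odd (B : A) (t : ℕ) :
    idp B 0 (2 * t + 1) = (qfact (2 * t + 1))⁻¹ •
      (B * idpProd B (fun r => qint (2 * (r + 1))) t) := by
  have h : (2 * (t : ℤ) + 1).toNat = 2 * t + 1 := by omega
  have h2 : (2 * t + 1 + 1) / 2 - 1 = t := by omega
  rw [idp, if_neg (by omega), if_neg (by omega), if_pos rfl, if_neg (by omega), h, h2, pow_one]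
  rfl

lemma idp_even_even (B : A) (t : ℕ) :
    idp B 0 (2 * t + 2) = (qfact (2 * t + 2))⁻¹ •
      (B ^ 2 * idpProd B (fun r => qint (2 * (r + 1))) t) := by
  have h : (2 * (t : ℤ) + 2).toNat = 2 * t + 2 := by omega
  have h2 : (2 * t + 2 + 1) / 2 - 1 = t := by omega
  rw [idp, if_neg (by omega), if_neg (by omega), if_pos rfl, if_pos (by omega), h, h2]
  rfl

lemma idp_odd_odd (B : A) (t : ℕ) :
    idp B 1 (2 * t + 1) = (qfact (2 * t + 1))⁻¹ •
      (B * idpProd B (fun r => qint (2 * (r + 1) - 1)) t) := by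
  have h : (2 * (t : ℤ) + 1).toNat = 2 * t + 1 := by omega
  have h2 : (2 * t + 1) / 2 = t := by omega
  rw [idp, if_neg (by omega), if_neg (by omega), if_neg one_ne_zero, if_neg (by omega), h, h2,
    pow_one]
  rfl

lemma idp_odd_even (B : A) (t : ℕ) :
    idp B 1 (2 * t) = (qfact (2 * t))⁻¹ •
      idpProd B (fun r => qint (2 * (r + 1) - 1)) t := by
  rcases t.eq_zero_or_pos with rfl | ht
  · simp [idp_zero, idpProd, qfact_zero]
  have h : (2 * (t : ℤ)).toNat = 2 * t := by omega
  have h2 : 2 * t / 2 = t := by omega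
  rw [idp, if_neg (by omega), if_neg (by omega), if_neg one_ne_zero, if_pos (by omega), h, h2,
    pow_zero, one_mul]
  rfl

lemma zmod_two_cases (p : ZMod 2) : p = 0 ∨ p = 1 := by
  revert p
  decide

lemma commute_idp (B : A) (p : ZMod 2) (m : ℤ) : Commute B (idp B p m) := by
  have key (a : F) (n : ℕ) (c : ℤ → F) (t : ℕ) : Commute B (a • (B ^ n * idpProd B c t)) :=
    (((Commute.refl B).pow_right n).mul_right (commute_idpProd B c t)).smul_right a
  rw [idp]
  split_ifs
  · exact Commute.zero_right B
  · exact Commute.one_right B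
  · exact key _ _ (fun r => qint (2 * (r + 1))) _
  · exact key _ _ (fun r => qint (2 * (r + 1))) _
  · exact key _ _ (fun r => qint (2 * (r + 1) - 1)) _
  · exact key _ _ (fun r => qint (2 * (r + 1) - 1)) _

lemma qint_smul_qfact_inv_smul {m : ℤ} {n : ℕ} (hm : m = n + 1) (x : A) :
    qint m • (qfact (n + 1))⁻¹ • x = (qfact n)⁻¹ • x := by
  have h : qint ((n : ℤ) + 1) ≠ 0 := qint_ne_zero (by omega)
  rw [hm, smul_smul, qfact_succ, mul_inv, mul_left_comm, mul_inv_cancel₀ h, mul_one]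

lemma qfact_inv_smul_mul_sq {B : A} {c : ℤ → F} {t n : ℕ} {m : ℤ} (hm : m = n + 1)
    (hc : c t = qint m) :
    (qfact (n + 1))⁻¹ • (B ^ 2 * idpProd B c t)
      = (qfact (n + 1))⁻¹ • idpProd B c (t + 1)
        - (qz (-1) * qint m) • (qfact n)⁻¹ • idpProd B c t := by
  rw [← qint_smul_qfact_inv_smul hm (idpProd B c t), idpProd_succ, hc, mul_add,
    ← ((commute_idpProd B c t).pow_left 2).eq, mul_smul_comm, mul_one, smul_add,
    eq_sub_iff_add_eq]
  congr 1
  simp only [smul_smul]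
  congr 1
  ring

lemma mul_idp_natCast_of_ne {B : A} {p : ZMod 2} {m : ℕ} (h : (m : ZMod 2) ≠ p) :
    B * idp B p m = qint (m + 1) • idp B p (m + 1) := by
  rcases zmod_two_cases p with rfl | rfl
  · obtain ⟨t, rfl | rfl⟩ := m.even_or_odd'
    · exact absurd (by push_cast; reduce_mod_char) h
    · have e : ((2 * t + 1 : ℕ) : ℤ) + 1 = 2 * t + 2 := by push_cast; ring
      rw [e, idp_even_even, qint_smul_qfact_inv_smul (by push_cast; ring)]
      push_cast
      rw [idp_even_odd, mul_smul_comm, sq, mul_assoc]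
  · obtain ⟨t, rfl | rfl⟩ := m.even_or_odd'
    · push_cast
      rw [idp_odd_odd, qint_smul_qfact_inv_smul (by push_cast; ring), idp_odd_even, mul_smul_comm]
    · exact absurd (by push_cast; reduce_mod_char) h

lemma mul_idp_natCast_of_eq {B : A} {p : ZMod 2} {m : ℕ} (h : (m : ZMod 2) = p) :
    B * idp B p m = qint (m + 1) • idp B p (m + 1) - (qz (-1) * qint m) • idp B p (m - 1) := by
  rcases zmod_two_cases p with rfl | rfl
  · obtain ⟨t, rfl | rfl⟩ := m.even_or_odd'
    · rcases t with _ | t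
      · have h1 := idp_even_odd B 0
        simp only [idpProd, qfact] at h1
        simp [idp_zero, qint_zero, qint_one] at h1 ⊢
        exact h1.symm
      · have e1 : ((2 * (t + 1) : ℕ) : ℤ) = 2 * t + 2 := by push_cast; ring
        have e2 : (2 * t + 2 + 1 : ℤ) = 2 * (t + 1 : ℕ) + 1 := by push_cast; ring
        have e3 : (2 * t + 2 - 1 : ℤ) = 2 * t + 1 := by ring
        rw [e1, e2, e3, idp_even_even, idp_even_odd, idp_even_odd,
          qint_smul_qfact_inv_smul (by push_cast; ring)]
        have h1 := congrArg (B * ·) (qfact_inv_smul_mul_sq (B := B) (n := 2 * t + 1)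
          (m := 2 * t + 2) (t := t) (c := fun r => qint (2 * (r + 1))) (by push_cast; ring)
          (by ring_nf))
        simp only [mul_sub, mul_smul_comm] at h1 ⊢
        exact h1
    · exact absurd h (by push_cast; reduce_mod_char; simp)
  · obtain ⟨t, rfl | rfl⟩ := m.even_or_odd'
    · exact absurd h (by push_cast; reduce_mod_char; simp)
    · have e1 : ((2 * t + 1 : ℕ) : ℤ) = 2 * t + 1 := by push_cast; ring
      have e2 : (2 * t + 1 + 1 : ℤ) = 2 * (t + 1 : ℕ) := by push_cast; ring
      have e3 : (2 * t + 1 - 1 : ℤ) = 2 * t := by ring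
      rw [e1, e2, e3, idp_odd_odd, idp_odd_even, idp_odd_even, mul_smul_comm, ← mul_assoc, ← sq,
        qfact_inv_smul_mul_sq (m := 2 * t + 1) (n := 2 * t) (by push_cast; ring) (by ring_nf)]
      congr 1
      exact (qint_smul_qfact_inv_smul (n := 2 * t + 1) (by push_cast; ring) _).symm

lemma mul_idp (B : A) (p : ZMod 2) (m : ℤ) :
    B * idp B p m = qint (m + 1) • idp B p (m + 1)
      - if (m : ZMod 2) = p then (qz (-1) * qint m) • idp B p (m - 1) else 0 := by
  rcases lt_or_ge m 0 with hm | hm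
  · rw [idp_of_neg B p hm, idp_of_neg B p (by omega : m - 1 < 0)]
    rcases eq_or_ne m (-1) with rfl | hm'
    · simp [qint_zero]
    · simp [idp_of_neg B p (by omega : m + 1 < 0)]
  lift m to ℕ using hm
  rw [Int.cast_natCast]
  split_ifs with h
  · exact mul_idp_natCast_of_eq h
  · rw [mul_idp_natCast_of_ne h, sub_zero]

/-- The sum `Σ_{y<M} f(y) B^{(j−2y)}_p`. -/
def idpSum (B : A) (p : ZMod 2) (M : ℕ) (f : ℤ → F) (j : ℤ) : A :=
  ∑ y ∈ Finset.range M, f y • idp B p (j - 2 * y)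

lemma commute_idpSum (B : A) (p : ZMod 2) (M : ℕ) (f : ℤ → F) (j : ℤ) :
    Commute B (idpSum B p M f j) :=
  Commute.sum_right _ _ _ fun _ _ => (commute_idp B p _).smul_right _

lemma idpSum_of_neg (B : A) (p : ZMod 2) (M : ℕ) (f : ℤ → F) {j : ℤ} (hj : j < 0) :
    idpSum B p M f j = 0 :=
  Finset.sum_eq_zero fun y _ => by rw [idp_of_neg B p (by omega), smul_zero]

lemma idpSum_zero_right (B : A) (p : ZMod 2) {M : ℕ} (hM : 0 < M) (f : ℤ → F) :
    idpSum B p M f 0 = f 0 • (1 : A) := by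
  rw [idpSum, Finset.sum_eq_single 0]
  · simp [idp_zero]
  · intro y _ hy
    rw [idp_of_neg B p (by omega), smul_zero]
  · intro h
    exact absurd (Finset.mem_range.2 hM) h

lemma smul_idpSum (B : A) (p : ZMod 2) (M : ℕ) (a : F) (f : ℤ → F) (j : ℤ) :
    a • idpSum B p M f j = idpSum B p M (fun y => a * f y) j := by
  simp only [idpSum, Finset.smul_sum, smul_smul]

lemma idpSum_sub (B : A) (p : ZMod 2) (M : ℕ) (f g : ℤ → F) (j : ℤ) :
    idpSum B p M f j - idpSum B p M g j = idpSum B p M (fun y => f y - g y) j := by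
  simp only [idpSum, ← Finset.sum_sub_distrib, sub_smul]

lemma idpSum_add (B : A) (p : ZMod 2) (M : ℕ) (f g : ℤ → F) (j : ℤ) :
    idpSum B p M f j + idpSum B p M g j = idpSum B p M (fun y => f y + g y) j := by
  simp only [idpSum, ← Finset.sum_add_distrib, add_smul]

lemma idpSum_sub_one (B : A) (p : ZMod 2) {M : ℕ} {f : ℤ → F} {j : ℤ} (hM : j + 1 < 2 * M)
    (hf : f (-1) = 0) :
    idpSum B p M f (j - 1) = idpSum B p M (fun y => f (y - 1)) (j + 1) := by
  have h : idpSum B p M (fun y => f (y - 1)) (j + 1)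
      = idpSum B p (M + 1) (fun y => f (y - 1)) (j + 1) := by
    rw [idpSum, idpSum, Finset.sum_range_succ, idp_of_neg B p (by omega : j + 1 - 2 * (M : ℤ) < 0),
      smul_zero, add_zero]
  rw [h, idpSum, idpSum, Finset.sum_range_succ']
  simp only [Nat.cast_zero, zero_sub, hf, zero_smul, add_zero]
  refine Finset.sum_congr rfl fun y _ => ?_
  push_cast
  congr 2 <;> ring

lemma mul_idpSum (B : A) {p : ZMod 2} {M : ℕ} {f : ℤ → F} {j : ℤ} (hM : j + 1 < 2 * M)
    (hf : f (-1) = 0) {P : Prop} [Decidable P] (hP : (j : ZMod 2) = p ↔ P) :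
    B * idpSum B p M f j = idpSum B p M (fun y => f y * qint (j - 2 * y + 1)
      - if P then f (y - 1) * (qz (-1) * qint (j - 2 * (y - 1))) else 0) (j + 1) := by
  have h2 (y : ℕ) : ((j - 2 * y : ℤ) : ZMod 2) = j := by push_cast; reduce_mod_char
  have h : B * idpSum B p M f j = idpSum B p M (fun y => f y * qint (j - 2 * y + 1)) (j + 1)
      - idpSum B p M (fun y => if P then f y * (qz (-1) * qint (j - 2 * y)) else 0) (j - 1) := by
    simp only [idpSum, Finset.mul_sum, ← Finset.sum_sub_distrib, mul_smul_comm]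
    refine Finset.sum_congr rfl fun y _ => ?_
    rw [mul_idp, h2, show j - 2 * (y : ℤ) + 1 = j + 1 - 2 * y by ring,
      show j - 2 * (y : ℤ) - 1 = j - 1 - 2 * y by ring]
    by_cases h : P
    · rw [if_pos (hP.2 h), if_pos h, smul_sub, smul_smul, smul_smul]
    · rw [if_neg (mt hP.1 h), if_neg h, sub_zero, zero_smul, sub_zero, smul_smul]
  rw [h, idpSum_sub_one B p hM (by simp [hf]), idpSum_sub]

lemma lower_idpSum_rec (B : A) {p : ZMod 2} {M : ℕ} {n j : ℤ} (k : ℤ) (hn : 0 ≤ n)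
    (hM : j + 1 < 2 * M) (hp : (j : ZMod 2) = p ↔ Odd n) :
    qz (n - k + j) • (B * (qz (j * n) • idpSum B p M (lowerCoeff n) j))
      - (qz (n - 2 - k + j) * qint n) •
        (qz ((j - 1) * (n - 1)) • idpSum B p M (lowerCoeff (n - 1)) (j - 1))
      + qint (k - j) • (qz ((j + 1) * (n + 1)) • idpSum B p M (lowerCoeff (n + 1)) (j + 1))
      = qint (k + 1) • (qz ((j + 1) * n) • idpSum B p M (upperCoeff n) (j + 1)) := by
  rw [mul_smul_comm, mul_idpSum B hM (lowerCoeff_neg_one n) hp,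
    idpSum_sub_one B p hM (lowerCoeff_neg_one _)]
  simp only [smul_idpSum, idpSum_sub, idpSum_add]
  congr 1
  funext y
  linear_combination lowerCoeff_rec hn k j y

lemma upper_idpSum_rec (B : A) {p : ZMod 2} {M : ℕ} {n j : ℤ} (k : ℤ) (hn : 0 ≤ n)
    (hM : j + 1 < 2 * M) (hp : (j : ZMod 2) = p ↔ Even n) :
    qz (n - k + j) • (B * (qz (j * n) • idpSum B p M (upperCoeff n) j))
      - (qz (n - 2 - k + j) * qint n) •
        (qz ((j - 1) * (n - 1)) • idpSum B p M (upperCoeff (n - 1)) (j - 1))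
      + qint (k - j) • (qz ((j + 1) * (n + 1)) • idpSum B p M (upperCoeff (n + 1)) (j + 1))
      = qint (k + 1) • (qz ((j + 1) * n) • idpSum B p M (lowerCoeff n) (j + 1))
        - (qz (-1) * qint k) • (qz ((j - 1) * n) • idpSum B p M (lowerCoeff n) (j - 1)) := by
  rw [mul_smul_comm, mul_idpSum B hM (upperCoeff_neg_one n) hp,
    idpSum_sub_one B p hM (upperCoeff_neg_one _), idpSum_sub_one B p hM (lowerCoeff_neg_one _)]
  simp only [smul_idpSum, idpSum_sub, idpSum_add]
  congr 1
  funext y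
  linear_combination upperCoeff_rec hn k j y

end IdividedPowers

section Recursion

lemma sum_range_shift {G : Type*} [AddCommGroup G] {M : ℕ} {h : ℕ → G} (h0 : h 0 = 0)
    (hM : h M = 0) :
    ∑ n ∈ Finset.range M, h (n + 1) = ∑ n ∈ Finset.range M, h n := by
  have := (Finset.sum_range_succ' h M).symm.trans (Finset.sum_range_succ h M)
  rwa [h0, hM, add_zero, add_zero] at this

variable {A : Type*} [Ring A] [Algebra F A] {B : A} {N : ℕ} {b : ℤ → A}

lemma mul_of_rec {n : ℤ}
    (hrec : B * b n - qz ((N : ℤ) - 2 * n) • (b n * B) = qint (n + 1) • b (n + 1)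
      + (qint (n - 1 - (N : ℤ)) * qz ((N : ℤ) - 2 * n)) • b (n - 1)) :
    b n * B = qz (2 * n - N) • (B * b n) - (qz (2 * n - N) * qint (n + 1)) • b (n + 1)
      + qint (N + 1 - n) • b (n - 1) := by
  have h : qz (2 * n - N) * qz (N - 2 * n) = 1 := by rw [← qz_add, ← qz_zero]; ring_nf
  have h2 : qint (n - 1 - N) = -qint (N + 1 - n) := by rw [← qint_neg]; ring_nf
  have h3 := congrArg (qz (2 * n - N) • ·) hrec
  simp only [smul_sub, smul_add, smul_smul, h, one_smul, h2] at h3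
  rw [show qz (2 * n - N) * (-qint (N + 1 - n) * qz (N - 2 * n)) = -qint (N + 1 - n) by
    linear_combination -qint (N + 1 - n) * h, neg_smul, sub_eq_iff_eq_add] at h3
  rw [h3]
  abel

lemma sum_mul_of_rec (hneg : b (-1) = 0) (hbig : b (N + 1) = 0)
    (hrec : ∀ m : ℤ, 0 ≤ m →
      B * b m - qz ((N : ℤ) - 2 * m) • (b m * B)
        = qint (m + 1) • b (m + 1)
          + (qint (m - 1 - (N : ℤ)) * qz ((N : ℤ) - 2 * m)) • b (m - 1))
    {c : ℤ → A} (hc : ∀ n, Commute B (c n)) :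
    (∑ n ∈ Finset.range (N + 1), c n * b n) * B
      = ∑ n ∈ Finset.range (N + 1), (qz (2 * n - N) • (B * c n)
          - (qz (2 * n - 2 - N) * qint n) • c (n - 1) + qint (N - n) • c (n + 1)) * b n := by
  have h1 : ∑ n ∈ Finset.range (N + 1), (qz (2 * n - N) * qint (n + 1)) • (c n * b (n + 1))
      = ∑ n ∈ Finset.range (N + 1), (qz (2 * n - 2 - N) * qint n) • (c (n - 1) * b n) := by
    rw [← sum_range_shift (h := fun n : ℕ =>
      (qz (2 * n - 2 - N) * qint n) • (c (n - 1) * b n)) (by simp [qint_zero]) (by simp [hbig])]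
    refine Finset.sum_congr rfl fun n _ => ?_
    push_cast
    rw [add_sub_cancel_right, mul_add, mul_one, add_sub_cancel_right]
  have h2 : ∑ n ∈ Finset.range (N + 1), qint (N + 1 - n) • (c n * b (n - 1))
      = ∑ n ∈ Finset.range (N + 1), qint (N - n) • (c (n + 1) * b n) := by
    rw [← sum_range_shift (h := fun n : ℕ => qint (N + 1 - n) • (c n * b (n - 1)))
      (by simp [hneg]) (by simp [qint_zero])]
    refine Finset.sum_congr rfl fun n _ => ?_
    push_cast
    rw [add_sub_cancel_right, add_sub_add_right_eq_sub]
  simp only [add_mul, sub_mul, smul_mul_assoc, Finset.sum_add_distrib, Finset.sum_sub_distrib]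
  rw [← h1, ← h2, ← Finset.sum_sub_distrib, ← Finset.sum_add_distrib, Finset.sum_mul]
  refine Finset.sum_congr rfl fun n _ => ?_
  rw [mul_assoc, mul_of_rec (hrec n (Int.natCast_nonneg n)), mul_add, mul_sub, mul_smul_comm,
    mul_smul_comm, mul_smul_comm, ← mul_assoc, (hc n).eq]

/-- The sum `Σ_n q^{(k−N+n)n} (Σ_{y<M} f_n(y) B^{(k−N+n−2y)}_p) b_n`. -/
def idpCombination (B : A) (N : ℕ) (b : ℤ → A) (M : ℕ) (f : ℤ → ℤ → F) (p : ZMod 2) (k : ℤ) : A :=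
  ∑ n ∈ Finset.range (N + 1), (qz ((k - N + n) * n) • idpSum B p M (f n) (k - N + n)) * b n

lemma idpCombination_of_neg (M : ℕ) (f : ℤ → ℤ → F) (p : ZMod 2) {k : ℤ} (hk : k < 0) :
    idpCombination B N b M f p k = 0 := by
  refine Finset.sum_eq_zero fun n hn => ?_
  have := Finset.mem_range.1 hn
  rw [idpSum_of_neg _ _ _ _ (by omega), smul_zero, zero_mul]

lemma idpCombination_zero {M : ℕ} (hM : 0 < M) {f : ℤ → ℤ → F} (hf : f N 0 = 1) (p : ZMod 2) :
    idpCombination B N b M f p 0 = b N := by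
  rw [idpCombination, Finset.sum_range_succ, Finset.sum_eq_zero, zero_add, zero_sub,
    neg_add_cancel, zero_mul, qz_zero, idpSum_zero_right _ _ hM, hf, one_smul, one_smul, one_mul]
  intro n hn
  have := Finset.mem_range.1 hn
  rw [idpSum_of_neg _ _ _ _ (by omega), smul_zero, zero_mul]

lemma lower_idpCombination_mul (hneg : b (-1) = 0) (hbig : b (N + 1) = 0)
    (hrec : ∀ m : ℤ, 0 ≤ m →
      B * b m - qz ((N : ℤ) - 2 * m) • (b m * B)
        = qint (m + 1) • b (m + 1)
          + (qint (m - 1 - (N : ℤ)) * qz ((N : ℤ) - 2 * m)) • b (m - 1))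
    {M : ℕ} {k : ℤ} (hM : k + 1 < 2 * M) {p : ZMod 2} (hp : p = ((k + 1 + N : ℤ) : ZMod 2)) :
    idpCombination B N b M lowerCoeff p k * B
      = qint (k + 1) • idpCombination B N b M upperCoeff p (k + 1) := by
  rw [idpCombination, sum_mul_of_rec hneg hbig hrec (c := fun n =>
    qz ((k - N + n) * n) • idpSum B p M (lowerCoeff n) (k - N + n))
    fun n => (commute_idpSum B _ _ _ _).smul_right _]
  simp only [idpCombination, Finset.smul_sum]
  refine Finset.sum_congr rfl fun n hn => ?_
  have hn := Finset.mem_range.1 hn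
  have hpar : ((k - N + n : ℤ) : ZMod 2) = p ↔ Odd (n : ℤ) := by
    rw [hp, ZMod.intCast_eq_intCast_iff, Int.ModEq, Int.odd_iff]
    push_cast
    omega
  have key := lower_idpSum_rec B (M := M) k (Int.natCast_nonneg n) (by omega) hpar
  rw [show (n : ℤ) - k + (k - N + n) = 2 * n - N by ring,
    show (n : ℤ) - 2 - k + (k - N + n) = 2 * n - 2 - N by ring,
    show k - (k - N + n) = N - n by ring] at key
  rw [show k - N + (n : ℤ) - 1 = k - N + (n - 1) by ring,
    show k - N + (n : ℤ) + 1 = k - N + (n + 1) by ring] at key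
  rw [← smul_mul_assoc (qint (k + 1)), show k + 1 - N + (n : ℤ) = k - N + (n + 1) by ring]
  exact congrArg (· * b n) key

lemma upper_idpCombination_mul (hneg : b (-1) = 0) (hbig : b (N + 1) = 0)
    (hrec : ∀ m : ℤ, 0 ≤ m →
      B * b m - qz ((N : ℤ) - 2 * m) • (b m * B)
        = qint (m + 1) • b (m + 1)
          + (qint (m - 1 - (N : ℤ)) * qz ((N : ℤ) - 2 * m)) • b (m - 1))
    {M : ℕ} {k : ℤ} (hM : k + 1 < 2 * M) {p : ZMod 2} (hp : p = ((k + N : ℤ) : ZMod 2)) :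
    idpCombination B N b M upperCoeff p k * B
      = qint (k + 1) • idpCombination B N b M lowerCoeff p (k + 1)
        - (qz (-1) * qint k) • idpCombination B N b M lowerCoeff p (k - 1) := by
  rw [idpCombination, sum_mul_of_rec hneg hbig hrec (c := fun n =>
    qz ((k - N + n) * n) • idpSum B p M (upperCoeff n) (k - N + n))
    fun n => (commute_idpSum B _ _ _ _).smul_right _]
  simp only [idpCombination, Finset.smul_sum, ← Finset.sum_sub_distrib]
  refine Finset.sum_congr rfl fun n hn => ?_
  have hn := Finset.mem_range.1 hn
  have hpar : ((k - N + n : ℤ) : ZMod 2) = p ↔ Even (n : ℤ) := by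
    rw [hp, ZMod.intCast_eq_intCast_iff, Int.ModEq, Int.even_iff]
    push_cast
    omega
  have key := upper_idpSum_rec B (M := M) k (Int.natCast_nonneg n) (by omega) hpar
  rw [show (n : ℤ) - k + (k - N + n) = 2 * n - N by ring,
    show (n : ℤ) - 2 - k + (k - N + n) = 2 * n - 2 - N by ring,
    show k - (k - N + n) = N - n by ring] at key
  rw [show k - N + (n : ℤ) - 1 = k - N + (n - 1) by ring,
    show k - N + (n : ℤ) + 1 = k - N + (n + 1) by ring] at key
  rw [← smul_mul_assoc (qint (k + 1)), ← smul_mul_assoc (qz (-1) * qint k), ← sub_mul,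
    show k + 1 - N + (n : ℤ) = k - N + (n + 1) by ring,
    show k - 1 - N + (n : ℤ) = k - N + (n - 1) by ring]
  exact congrArg (· * b n) key

/-- Moving `b_N` past idivided powers of both parities. -/
lemma mul_idp_eq_idpCombination (hneg : b (-1) = 0) (hbig : b (N + 1) = 0)
    (hrec : ∀ m : ℤ, 0 ≤ m →
      B * b m - qz ((N : ℤ) - 2 * m) • (b m * B)
        = qint (m + 1) • b (m + 1)
          + (qint (m - 1 - (N : ℤ)) * qz ((N : ℤ) - 2 * m)) • b (m - 1))
    {M : ℕ} (k : ℕ) (hM : k < 2 * M) :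
    b N * idp B ((k : ℤ) : ZMod 2) k
        = idpCombination B N b M upperCoeff ((k + N : ℤ) : ZMod 2) k ∧
      b N * idp B ((k + 1 : ℤ) : ZMod 2) k
        = idpCombination B N b M lowerCoeff ((k + 1 + N : ℤ) : ZMod 2) k ∧
      b N * idp B ((k : ℤ) : ZMod 2) (k - 1)
        = idpCombination B N b M lowerCoeff ((k + N : ℤ) : ZMod 2) (k - 1) := by
  induction k with
  | zero =>
    simp only [Nat.cast_zero]
    rw [idpCombination_zero (f := upperCoeff) (by omega) (signedCoeff_zero _ _),
      idpCombination_zero (f := lowerCoeff) (by omega) (signedCoeff_zero _ _), idp_zero, idp_zero,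
      mul_one,
      idp_of_neg _ _ (by omega), mul_zero, idpCombination_of_neg _ _ _ (by omega)]
    exact ⟨rfl, rfl, rfl⟩
  | succ k ih =>
    obtain ⟨h1, h2, h3⟩ := ih (by omega)
    have hk : qint ((k : ℤ) + 1) ≠ 0 := qint_ne_zero (by omega)
    have hlow := lower_idpCombination_mul hneg hbig hrec (M := M) (k := k) (by omega) rfl
    have hupp := upper_idpCombination_mul hneg hbig hrec (M := M) (k := k) (by omega) rfl
    rw [← h2, mul_assoc, ← (commute_idp B _ _).eq, mul_idp, if_neg, sub_zero, mul_smul_comm]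
      at hlow
    rw [← h1, mul_assoc, ← (commute_idp B _ _).eq, mul_idp, if_pos rfl, mul_sub, mul_smul_comm,
      mul_smul_comm, h3, sub_left_inj] at hupp
    · push_cast at h2 hlow hupp ⊢
      rw [add_sub_cancel_right, h2]
      refine ⟨smul_right_injective A hk hlow, ?_, rfl⟩
      have e : (k : ZMod 2) + 1 + 1 = k := by rw [add_assoc]; reduce_mod_char
      rw [e]
      exact smul_right_injective A hk hupp
    · rw [ZMod.intCast_eq_intCast_iff, Int.ModEq]
      omega

lemma idpCombination_eq_sum {M : ℕ} (hM : N < M) {f : ℤ → ℤ → F} {a : ℕ → ℕ} {e : ℕ → ℤ}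
    (ha : ∀ n, a n ≤ n) (hf : ∀ n y : ℕ, f n y = signedCoeff (a n) (e n) y) (p : ZMod 2) (k : ℤ) :
    idpCombination B N b M f p k = ∑ x ∈ Finset.range (N + 1),
      (qz ((k - x) * ((N : ℤ) - x)) • ∑ y ∈ Finset.range (a (N - x) + 1),
        ((-1 : F) ^ y * qz (2 * (y : ℤ) * e (N - x)) * qbinom2 (a (N - x)) y) •
          idp B p (k - x - 2 * y)) * b ((N : ℤ) - x) := by
  rw [idpCombination, ← Finset.sum_range_reflect]
  refine Finset.sum_congr rfl fun x hx => ?_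
  have hx := Finset.mem_range.1 hx
  rw [show N + 1 - 1 - x = N - x by omega, ← Nat.cast_sub (by omega : x ≤ N),
    show k - N + ((N - x : ℕ) : ℤ) = k - x by omega]
  congr 2
  have hsub : Finset.range (a (N - x) + 1) ⊆ Finset.range M := by
    have := ha (N - x)
    exact Finset.range_subset_range.2 (by omega)
  rw [idpSum, ← Finset.sum_subset hsub]
  · refine Finset.sum_congr rfl fun y _ => ?_
    rw [hf, signedCoeff, qchoose_natCast, zpow_natCast]
  · intro y _ hy
    rw [Finset.mem_range, not_lt] at hy
    rw [hf, signedCoeff, qchoose_natCast, qbinom2_eq_zero (by omega), mul_zero, zero_smul]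

end Recursion

end SplitIdp

/-- Proposition A (split rank-two identities, Proposition `prop:BBij2` of the paper):
given a family `(b_m)` vanishing for `m < 0` and `m > N` and satisfying the recursion
`B·b_m − q^{N−2m}·b_m·B = [m+1]·b_{m+1} + [m−1−N]·q^{N−2m}·b_{m−1}`, for every `k ≥ 0`:
(i) `b_N·B^{(k)}_{k̄} = Σ_{x=0}^{N} q^{(k−x)(N−x)}
      (Σ_{y=0}^{⌈(N−x)/2⌉} (−1)^y q^{2y(⌈(N−x)/2⌉−1−N+x)} ⌊⌈(N−x)/2⌉ ¦ y⌋_{q²}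
        B^{(k−x−2y)}_{(k+N) mod 2}) · b_{N−x}`, and
(ii) `b_N·B^{(k)}_{(k+1) mod 2} = Σ_{x=0}^{N} q^{(k−x)(N−x)}
      (Σ_{y=0}^{⌊(N−x)/2⌋} (−1)^y q^{2y(⌊(N−x)/2⌋−N+x)} ⌊⌊(N−x)/2⌋ ¦ y⌋_{q²}
        B^{(k−x−2y)}_{(k+1+N) mod 2}) · b_{N−x}`. -/
theorem statement8 (A : Type*) [Ring A] [Algebra F A] (B : A)
    (N : ℕ) (b : ℤ → A)
    (hneg : ∀ m : ℤ, m < 0 → b m = 0)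
    (hbig : ∀ m : ℤ, (N : ℤ) < m → b m = 0)
    (hrec : ∀ m : ℤ, 0 ≤ m →
      B * b m - qz ((N : ℤ) - 2 * m) • (b m * B)
        = qint (m + 1) • b (m + 1)
          + (qint (m - 1 - (N : ℤ)) * qz ((N : ℤ) - 2 * m)) • b (m - 1))
    (k : ℕ) :
    (b (N : ℤ) * idp B ((k : ℕ) : ZMod 2) (k : ℤ)
      = ∑ x ∈ Finset.range (N + 1),
          (qz (((k : ℤ) - x) * ((N : ℤ) - x)) •
              ∑ y ∈ Finset.range ((N - x + 1) / 2 + 1),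
                ((-1 : F) ^ y *
                    qz (2 * (y : ℤ) * ((((N - x + 1) / 2 : ℕ) : ℤ) - 1 - (N : ℤ) + x)) *
                    qbinom2 (((N - x + 1) / 2 : ℕ) : ℤ) y) •
                  idp B ((k + N : ℕ) : ZMod 2) ((k : ℤ) - x - 2 * y))
            * b ((N : ℤ) - x))
    ∧
    (b (N : ℤ) * idp B ((k + 1 : ℕ) : ZMod 2) (k : ℤ)
      = ∑ x ∈ Finset.range (N + 1),
          (qz (((k : ℤ) - x) * ((N : ℤ) - x)) •
              ∑ y ∈ Finset.range ((N - x) / 2 + 1),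
                ((-1 : F) ^ y *
                    qz (2 * (y : ℤ) * ((((N - x) / 2 : ℕ) : ℤ) - (N : ℤ) + x)) *
                    qbinom2 (((N - x) / 2 : ℕ) : ℤ) y) •
                  idp B ((k + 1 + N : ℕ) : ZMod 2) ((k : ℤ) - x - 2 * y))
            * b ((N : ℤ) - x)) := by
  obtain ⟨h1, h2, -⟩ := mul_idp_eq_idpCombination (hneg (-1) (by omega)) (hbig (N + 1) (by omega))
    hrec (M := N + k + 1) k (by omega)
  rw [idpCombination_eq_sum (by omega) (a := fun n => (n + 1) / 2)
    (e := fun n => (((n + 1) / 2 : ℕ) : ℤ) - 1 - n) (fun n => by omega)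
    (fun n y => by simp [upperCoeff])] at h1
  rw [idpCombination_eq_sum (by omega) (a := fun n => n / 2)
    (e := fun n => ((n / 2 : ℕ) : ℤ) - n) (fun n => by omega)
    (fun n y => by simp [lowerCoeff])] at h2
  push_cast at h1 h2 ⊢
  constructor
  · rw [h1]
    refine Finset.sum_congr rfl fun x hx => ?_
    have hx := Finset.mem_range.1 hx
    rw [Nat.cast_sub (by omega : x ≤ N)]
    simp only [← sub_add]
  · rw [h2]
    refine Finset.sum_congr rfl fun x hx => ?_
    have hx := Finset.mem_range.1 hx
    rw [Nat.cast_sub (by omega : x ≤ N)]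
    simp only [← sub_add]
end
end

section
/- On the module L(n) of the context, set p := n mod 2. For every integer ℓ with 0 ≤ 2ℓ ≤ n, the following identity holds: v_{n−2ℓ} = Σ_{c=0}^{⌊n/2⌋−ℓ} (−1)^c q^{−(2ℓ+1)c} ⌊ℓ+c ¦ c⌋_{q²} · B^{(n−2ℓ−2c)}_{p̄}(v₀). (This inverts the expansion of the icanonical basis in the canonical basis of L(n), even-indexed case.) -/
set_option synthInstance.maxHeartbeats 1000000
set_option maxHeartbeats 2000000

noncomputable section

namespace Lnmod

/-- The base field `F = ℚ(q)`. -/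
abbrev F : Type := RatFunc ℚ

/-- `q^e` for `e : ℤ`. -/
def qz (e : ℤ) : F := (RatFunc.X : F) ^ e

/-- The quantum integer `[n]`. -/
def qint (n : ℤ) : F := (qz n - qz (-n)) / (qz 1 - qz (-1))

/-- The quantum factorial `[n]!`. -/
def qfact (n : ℕ) : F := ∏ i ∈ Finset.range n, qint ((i : ℤ) + 1)

/-- The balanced Gaussian binomial coefficient in the variable `q²`. -/
def qbinom2 (a : ℤ) (k : ℕ) : F :=
  ∏ s ∈ Finset.range k,
    (qz (2 * (a - s)) - qz (-(2 * (a - s)))) /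
      (qz (2 * ((s : ℤ) + 1)) - qz (-(2 * ((s : ℤ) + 1))))

/-- The underlying space of the simple `U_q(sl₂)`-module `L(n)`, with basis `v₀, …, v_n`. -/
abbrev V (n : ℕ) : Type := Fin (n + 1) → F

/-- The basis vector `v_k` of `L(n)`. -/
def vb (n : ℕ) (k : Fin (n + 1)) : V n := Pi.single k 1

/-- The operator `F` on `L(n)`: `F(v_k) = [k+1]·v_{k+1}` (and `v_{n+1} = 0`). -/
def Fop (n : ℕ) : Module.End F (V n) :=
  Matrix.toLin'
    (Matrix.of fun i j : Fin (n + 1) =>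
      if (i : ℕ) = (j : ℕ) + 1 then qint ((j : ℕ) + 1) else 0)

/-- The operator `E` on `L(n)`: `E(v_k) = [n+1−k]·v_{k−1}` (and `v_{−1} = 0`). -/
def Eop (n : ℕ) : Module.End F (V n) :=
  Matrix.toLin'
    (Matrix.of fun i j : Fin (n + 1) =>
      if (i : ℕ) + 1 = (j : ℕ) then qint ((n : ℤ) + 1 - (j : ℕ)) else 0)

/-- The operator `K⁻¹` on `L(n)`: `K⁻¹(v_k) = q^{−(n−2k)}·v_k`. -/
def Kinvop (n : ℕ) : Module.End F (V n) :=
  Matrix.toLin'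
    (Matrix.of fun i j : Fin (n + 1) =>
      if i = j then qz (-((n : ℤ) - 2 * (i : ℕ))) else 0)

/-- `B := F + q^{−1}·E·K^{−1}`. -/
def Bop (n : ℕ) : Module.End F (V n) := Fop n + qz (-1) • (Eop n * Kinvop n)

/-- The idivided powers `B^{(m)}_{p̄}` of an element `B`, with parameter `ς = q^{−1}`:
`B^{(0)}_{p̄} = 1`; for `m ≥ 1`,
`B^{(m)}_{0̄} = (1/[m]!)·B^{1+δ}·∏_{r=1}^{⌈m/2⌉−1}(B² − [2r]²·1)` (δ = 1 iff m even), and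
`B^{(m)}_{1̄} = (1/[m]!)·B^{ε}·∏_{r=1}^{⌊m/2⌋}(B² − [2r−1]²·1)` (ε = 1 iff m odd);
`B^{(m)}_{p̄} = 0` for `m < 0`. -/
def idp {A : Type*} [Ring A] [Algebra F A] (B : A) (p : ZMod 2) (m : ℤ) : A :=
  if m < 0 then 0
  else if m = 0 then 1
  else if p = 0 then
    (qfact m.toNat)⁻¹ •
      (B ^ (if m % 2 = 0 then 2 else 1) *
        ((List.range ((m.toNat + 1) / 2 - 1)).map
            (fun r => B ^ 2 - (qint (2 * ((r : ℤ) + 1)) ^ 2) • (1 : A))).prod)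
  else
    (qfact m.toNat)⁻¹ •
      (B ^ (if m % 2 = 0 then 0 else 1) *
        ((List.range (m.toNat / 2)).map
            (fun r => B ^ 2 - (qint (2 * ((r : ℤ) + 1) - 1) ^ 2) • (1 : A))).prod)

end Lnmod

open Lnmod

namespace Lnmod

lemma qz_add (a b : ℤ) : qz (a + b) = qz a * qz b :=
  zpow_add₀ RatFunc.X_ne_zero a b

lemma qz_sub (a b : ℤ) : qz (a - b) = qz a / qz b :=
  zpow_sub₀ RatFunc.X_ne_zero a b

lemma qz_neg (a : ℤ) : qz (-a) = (qz a)⁻¹ := zpow_neg _ a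

lemma qz_mul_natCast (k : ℕ) (a : ℤ) : qz (k * a) = qz a ^ k := by
  rw [mul_comm, qz, zpow_mul, zpow_natCast, qz]

lemma qz_ne_zero (a : ℤ) : qz a ≠ 0 := zpow_ne_zero a RatFunc.X_ne_zero

lemma qz_zero : qz 0 = 1 := zpow_zero _

lemma X_pow_ne_one {k : ℕ} (hk : k ≠ 0) : (RatFunc.X : F) ^ k ≠ 1 := by
  intro h
  rw [← RatFunc.algebraMap_X, ← map_pow, ← map_one (algebraMap (Polynomial ℚ) F)] at h
  have h' := congrArg Polynomial.natDegree (RatFunc.algebraMap_injective ℚ h)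
  simp [hk] at h'

lemma qz_ne_one {a : ℤ} (ha : a ≠ 0) : qz a ≠ 1 := by
  rcases Int.natAbs_eq a with h | h <;> rw [h]
  · rw [qz, zpow_natCast]
    exact X_pow_ne_one (Int.natAbs_ne_zero.mpr ha)
  · rw [qz_neg, qz, zpow_natCast]
    exact inv_ne_one.mpr (X_pow_ne_one (Int.natAbs_ne_zero.mpr ha))

lemma qz_sub_qz_neg_ne_zero {a : ℤ} (ha : a ≠ 0) : qz a - qz (-a) ≠ 0 := by
  intro h
  apply qz_ne_one (a := a + a) (by omega)
  rw [qz_add]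
  nth_rewrite 1 [sub_eq_zero.mp h]
  rw [← qz_add, neg_add_cancel, qz_zero]

lemma qint_ne_zero {a : ℤ} (ha : a ≠ 0) : qint a ≠ 0 :=
  div_ne_zero (qz_sub_qz_neg_ne_zero ha) (qz_sub_qz_neg_ne_zero one_ne_zero)

lemma qint_zero : qint 0 = 0 := by simp [qint]

lemma qint_one : qint 1 = 1 := div_self (qz_sub_qz_neg_ne_zero one_ne_zero)

lemma qfact_succ (m : ℕ) : qfact (m + 1) = qfact m * qint (m + 1) :=
  Finset.prod_range_succ _ _

/-- `q^{2a} - q^{-2a}`. -/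
def qbr (a : ℤ) : F := qz (2 * a) - qz (-(2 * a))

lemma qbr_ne_zero {a : ℤ} (ha : a ≠ 0) : qbr a ≠ 0 := qz_sub_qz_neg_ne_zero (by omega)

lemma qbinom2_eq (a : ℤ) (k : ℕ) :
    qbinom2 a k = ∏ s ∈ Finset.range k, qbr (a - s) / qbr (s + 1) := rfl

lemma qbinom2_zero (a : ℤ) : qbinom2 a 0 = 1 := rfl

lemma qbinom2_succ_mul (a : ℤ) (k : ℕ) :
    qbinom2 a (k + 1) * qbr (k + 1) = qbr (a - k) * qbinom2 a k := by
  rw [qbinom2_eq, Finset.prod_range_succ, ← qbinom2_eq]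
  have := qbr_ne_zero (a := (k : ℤ) + 1) (by omega)
  field_simp

lemma qbinom2_succ_succ_mul (a : ℤ) (k : ℕ) :
    qbinom2 (a + 1) (k + 1) * qbr (k + 1) = qbr (a + 1) * qbinom2 a k := by
  have h : ∏ s ∈ Finset.range k, qbr (a + 1 - ((s + 1 : ℕ) : ℤ))
      = ∏ s ∈ Finset.range k, qbr (a - s) :=
    Finset.prod_congr rfl fun s _ => by congr 1; push_cast; ring
  have := qbr_ne_zero (a := (k : ℤ) + 1) (by omega)
  have h' : ∏ s ∈ Finset.range k, qbr ((s : ℤ) + 1) ≠ 0 :=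
    Finset.prod_ne_zero_iff.mpr fun i _ => qbr_ne_zero (by omega)
  rw [qbinom2_eq, qbinom2_eq, Finset.prod_div_distrib, Finset.prod_div_distrib,
    Finset.prod_range_succ', Finset.prod_range_succ, h]
  simp only [Nat.cast_zero, sub_zero]
  field_simp

/-- The coefficient of `B^{(n-2l-2c)}` in the expansion of `v_{n-2l}`. -/
def coef (l : ℤ) (c : ℕ) : F :=
  (-1 : F) ^ c * qz (-((2 * l + 1) * c)) * qbinom2 (l + c) c

lemma coef_zero (l : ℤ) : coef l 0 = 1 := by simp [coef, qbinom2_zero, qz_zero]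

lemma coef_succ_mul (l : ℤ) (c : ℕ) :
    coef l (c + 1) * qbr (c + 1) = -qz (-(2 * l + 1)) * qbr (l + c + 1) * coef l c := by
  have h := qbinom2_succ_succ_mul (l + c) c
  have e : -((2 * l + 1) * ((c + 1 : ℕ) : ℤ)) = -(2 * l + 1) + -((2 * l + 1) * c) := by
    push_cast; ring
  rw [coef, coef, e, qz_add, pow_succ]
  push_cast
  rw [← add_assoc]
  linear_combination (-1) ^ c * (-1) * qz (-(2 * l + 1)) * qz (-((2 * l + 1) * c)) * h

lemma coef_pred_succ_mul (l : ℤ) (c : ℕ) :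
    coef (l - 1) (c + 1) * qbr (c + 1) = -qz (2 * c - 2 * l + 1) * qbr l * coef l c := by
  have h := qbinom2_succ_mul (l + c) c
  have e : -((2 * (l - 1) + 1) * ((c + 1 : ℕ) : ℤ))
      = (2 * c - 2 * l + 1) + -((2 * l + 1) * c) := by
    push_cast; ring
  have e' : l - 1 + ((c + 1 : ℕ) : ℤ) = l + c := by push_cast; ring
  rw [add_sub_cancel_right] at h
  rw [coef, coef, e, e', qz_add, pow_succ]
  linear_combination (-1) ^ c * (-1) * qz (2 * c - 2 * l + 1) * qz (-((2 * l + 1) * c)) * h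

lemma coef_succ_pred_mul (l : ℤ) (c : ℕ) :
    coef (l + 1) c * qbr (l + 1)
      = -qz (2 * l - 2 * (c + 1 : ℕ) + 3) * qbr (c + 1) * coef l (c + 1) := by
  have h := coef_pred_succ_mul (l + 1) c
  rw [add_sub_cancel_right] at h
  have e : qz (2 * l - 2 * (c + 1 : ℕ) + 3) * qz (2 * c - 2 * (l + 1) + 1) = 1 := by
    rw [← qz_add, ← qz_zero]; congr 1; push_cast; ring
  linear_combination qz (2 * l - 2 * (c + 1 : ℕ) + 3) * h - qbr (l + 1) * coef (l + 1) c * e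

lemma coef_identity_field {K : Type*} [Field K] {q N P Y A : K}
    (hq : q ≠ 0) (hN : N ≠ 0) (hP : P ≠ 0) (hY : Y ≠ 0) (hd : q ^ 2 - 1 ≠ 0)
    (hc : Y ^ 2 * q ^ 4 - 1 ≠ 0) (hl : P ^ 2 * q ^ 4 - 1 ≠ 0) :
    A * ((N / P / Y - (N / P / Y)⁻¹) / (q - q⁻¹)) ^ 2
        + -(P * q)⁻¹ * (P * Y * q ^ 2 - (P * Y * q ^ 2)⁻¹) * A / (Y * q ^ 2 - (Y * q ^ 2)⁻¹)
          * ((N / P / Y / q - (N / P / Y / q)⁻¹) / (q - q⁻¹)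
            * ((N / P / Y - (N / P / Y)⁻¹) / (q - q⁻¹)))
      = (N / P * q - (N / P * q)⁻¹) / (q - q⁻¹)
          * ((N / P * q ^ 2 - (N / P * q ^ 2)⁻¹) / (q - q⁻¹))
          * (-(Y / P * q) * (P - P⁻¹) * A / (Y * q ^ 2 - (Y * q ^ 2)⁻¹))
        + ((N / P * q - (N / P * q)⁻¹) / (q - q⁻¹) * (N / P ^ 2 * q) * ((P - P⁻¹) / (q - q⁻¹))
          + N / P ^ 2 / q * ((P * q - (P * q)⁻¹) / (q - q⁻¹))
            * ((N / P - (N / P)⁻¹) / (q - q⁻¹))) * A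
        + N / P ^ 2 / q * ((P * q - (P * q)⁻¹) / (q - q⁻¹)) * (N / P ^ 2 / q ^ 3)
          * ((P * q ^ 2 - (P * q ^ 2)⁻¹) / (q - q⁻¹))
          * (-(P / Y * q ^ 3) * (Y - Y⁻¹) * A / (P * q ^ 2 - (P * q ^ 2)⁻¹)) := by
  have e₀ : q - q⁻¹ = (q ^ 2 - 1) / q := by field_simp
  have e₁ : Y * q ^ 2 - (Y * q ^ 2)⁻¹ = (Y ^ 2 * q ^ 4 - 1) / (Y * q ^ 2) := by field_simp
  have e₂ : P * q ^ 2 - (P * q ^ 2)⁻¹ = (P ^ 2 * q ^ 4 - 1) / (P * q ^ 2) := by field_simp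
  rw [e₀, e₁, e₂]
  field_simp
  ring

/-- The three-term recurrence satisfied by the expansion coefficients. -/
lemma coef_identity (n l c : ℤ) (hc : c + 1 ≠ 0) (hl : l + 1 ≠ 0) (A A₁ A₂ A₃ : F)
    (h₁ : A₁ * qbr (c + 1) = -qz (-(2 * l + 1)) * qbr (l + c + 1) * A)
    (h₂ : A₂ * qbr (c + 1) = -qz (2 * c - 2 * l + 1) * qbr l * A)
    (h₃ : A₃ * qbr (l + 1) = -qz (2 * l - 2 * c + 3) * qbr c * A) :
    A * qint (n - 2 * l - 2 * c) ^ 2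
        + A₁ * (qint (n - 2 * l - 2 * c - 1) * qint (n - 2 * l - 2 * c))
      = qint (n - 2 * l + 1) * qint (n - 2 * l + 2) * A₂
        + (qint (n - 2 * l + 1) * qz (n - 4 * l + 1) * qint (2 * l)
            + qz (n - 4 * l - 1) * qint (2 * l + 1) * qint (n - 2 * l)) * A
        + qz (n - 4 * l - 1) * qint (2 * l + 1) * qz (n - 4 * l - 3) * qint (2 * l + 2) * A₃ := by
  have hc' := qbr_ne_zero hc
  have hl' := qbr_ne_zero hl
  have sq_sub_one {a : ℤ} (ha : a ≠ 0) : qz a ^ 2 - 1 ≠ 0 := by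
    rw [← qz_mul_natCast]
    exact sub_ne_zero.mpr (qz_ne_one (by omega))
  have key := coef_identity_field (A := A) (qz_ne_zero 1) (qz_ne_zero n) (qz_ne_zero (2 * l))
    (qz_ne_zero (2 * c)) (sq_sub_one one_ne_zero)
    (by simpa only [qz_add, qz_mul_natCast, mul_pow, ← pow_mul] using
      sq_sub_one (a := 2 * c + (2 : ℕ) * 1) (by omega))
    (by simpa only [qz_add, qz_mul_natCast, mul_pow, ← pow_mul] using
      sq_sub_one (a := 2 * l + (2 : ℕ) * 1) (by omega))
  rw [eq_div_of_mul_eq hc' h₁, eq_div_of_mul_eq hc' h₂, eq_div_of_mul_eq hl' h₃]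
  simp only [qint, qbr, qz_neg]
  have q₂ : qz 2 = qz 1 ^ 2 := qz_mul_natCast 2 1
  have q₃ : qz 3 = qz 1 ^ 3 := qz_mul_natCast 3 1
  have q₄ : qz (4 * l) = qz (2 * l) ^ 2 := by rw [← qz_mul_natCast]; congr 1; push_cast; ring
  simp only [mul_add, qz_sub, qz_add, mul_one, q₂, q₃, q₄]
  exact key

/-- The vector `v_k` for an arbitrary integer `k`, zero unless `0 ≤ k ≤ n`. -/
def vz (n : ℕ) (k : ℤ) : V n := fun i => if (i : ℤ) = k then 1 else 0

lemma vz_natCast (n k : ℕ) (h : k < n + 1) : vz n k = vb n ⟨k, h⟩ := by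
  funext i
  simp [vz, vb, Pi.single_apply, Fin.ext_iff]

lemma vz_eq_zero {n : ℕ} {k : ℤ} (h : k < 0 ∨ (n : ℤ) < k) : vz n k = 0 := by
  funext i
  have := i.isLt
  simp only [vz, Pi.zero_apply, ite_eq_right_iff]
  omega

lemma Bop_vz (n : ℕ) (k : ℤ) :
    Bop n (vz n k)
      = qint (k + 1) • vz n (k + 1) + (qz (2 * k - n - 1) * qint (n + 1 - k)) • vz n (k - 1) := by
  by_cases h : k < 0 ∨ (n : ℤ) < k
  · rw [vz_eq_zero h, map_zero]
    have h₁ : qint (k + 1) • vz n (k + 1) = 0 := by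
      by_cases hk : k = -1
      · simp [hk, qint_zero]
      · rw [vz_eq_zero (by omega), smul_zero]
    have h₂ : (qz (2 * k - n - 1) * qint (n + 1 - k)) • vz n (k - 1) = 0 := by
      by_cases hk : k = n + 1
      · simp [hk, qint_zero]
      · rw [vz_eq_zero (by omega), smul_zero]
    rw [h₁, h₂, add_zero]
  · push Not at h
    obtain ⟨j, rfl⟩ := Int.eq_ofNat_of_zero_le h.1
    have hj : j < n + 1 := by omega
    have hF : Fop n (vz n j) = qint (j + 1) • vz n (j + 1) := by
      funext i
      rw [vz_natCast n j hj, vb, Fop, Matrix.toLin'_apply, Matrix.mulVec_single_one]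
      simp only [Matrix.col_apply, Matrix.of_apply, vz, Pi.smul_apply, smul_eq_mul, mul_ite,
        mul_one, mul_zero]
      exact if_congr (by omega) rfl rfl
    have hK : Kinvop n (vz n j) = qz (2 * j - n) • vz n j := by
      funext i
      have hv := vz_natCast n j hj
      rw [hv, vb, Kinvop, Matrix.toLin'_apply, Matrix.mulVec_single_one, ← vb, ← hv]
      simp only [Matrix.col_apply, Matrix.of_apply, vz, Pi.smul_apply, smul_eq_mul, mul_ite,
        mul_one, mul_zero, Fin.ext_iff, Nat.cast_inj]
      split_ifs with hi
      · rw [hi, neg_sub]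
      · rfl
    have hE : Eop n (vz n j) = qint (n + 1 - j) • vz n (j - 1) := by
      funext i
      rw [vz_natCast n j hj, vb, Eop, Matrix.toLin'_apply, Matrix.mulVec_single_one]
      simp only [Matrix.col_apply, Matrix.of_apply, vz, Pi.smul_apply, smul_eq_mul, mul_ite,
        mul_one, mul_zero]
      exact if_congr (by omega) rfl rfl
    have e : (2 * j - n - 1 : ℤ) = -1 + (2 * j - n) := by ring
    rw [Bop, LinearMap.add_apply, LinearMap.smul_apply, Module.End.mul_apply, hF, hK, map_smul, hE,
      smul_smul, smul_smul, e, qz_add]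

lemma Bop_sq_vz (n : ℕ) (k : ℤ) :
    (Bop n ^ 2) (vz n k)
      = (qint (k + 1) * qint (k + 2)) • vz n (k + 2)
        + (qint (k + 1) * qz (2 * k - n + 1) * qint (n - k)
          + qz (2 * k - n - 1) * qint (n + 1 - k) * qint k) • vz n k
        + (qz (2 * k - n - 1) * qint (n + 1 - k) * qz (2 * k - n - 3) * qint (n + 2 - k))
          • vz n (k - 2) := by
  rw [pow_two, Module.End.mul_apply, Bop_vz, map_add, map_smul, map_smul, Bop_vz, Bop_vz]
  rw [show k + 1 + 1 = k + 2 by ring, show k - 1 - 1 = k - 2 by ring, sub_add_cancel,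
    add_sub_cancel_right, show 2 * (k + 1) - n - 1 = 2 * k - n + 1 by ring,
    show 2 * (k - 1) - n - 1 = 2 * k - n - 3 by ring, show n + 1 - (k + 1) = n - k by ring,
    show n + 1 - (k - 1) = n + 2 - k by ring]
  simp only [smul_add, smul_smul, add_smul, mul_assoc]
  abel

lemma idp_of_neg {A : Type*} [Ring A] [Algebra F A] (B : A) (p : ZMod 2) {m : ℤ} (hm : m < 0) :
    idp B p m = 0 := if_pos hm

lemma idp_zero {A : Type*} [Ring A] [Algebra F A] (B : A) (p : ZMod 2) : idp B p 0 = 1 := by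
  simp [idp]

lemma idp_one_one {A : Type*} [Ring A] [Algebra F A] (B : A) : idp B 1 1 = B := by
  simp [idp, qfact, qint_one]

lemma sq_sub_mul_prod_range {A : Type*} [Ring A] [Algebra F A] (B : A) (g : ℤ → F) (j k : ℕ) :
    (B ^ 2 - g k • (1 : A)) * (B ^ j *
        ((List.range k >>= fun r => pure (r : ℤ)).map fun r => B ^ 2 - g r • (1 : A)).prod)
      = B ^ j *
        ((List.range (k + 1) >>= fun r => pure (r : ℤ)).map fun r => B ^ 2 - g r • (1 : A)).prod := by
  have hB (a : F) (i : ℕ) : Commute (B ^ 2 - a • (1 : A)) (B ^ i) :=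
    (Commute.pow_pow_self B 2 i).sub_left ((Commute.one_left _).smul_left a)
  have hP (a b : F) : Commute (B ^ 2 - a • (1 : A)) (B ^ 2 - b • (1 : A)) :=
    (hB a 2).sub_right ((Commute.one_right _).smul_right b)
  rw [List.range_succ]
  simp only [bind_pure_comp, List.map_eq_map, List.map_append, List.prod_append, List.map_cons,
    List.map_nil, List.prod_singleton]
  rw [← mul_assoc (B ^ j)]
  refine ((hB _ j).mul_right (Commute.list_prod_right _ _ fun x hx => ?_)).eq
  obtain ⟨r, -, rfl⟩ := List.mem_map.mp hx
  exact hP _ _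

lemma idp_even_add_two {A : Type*} [Ring A] [Algebra F A] (B : A) (k : ℕ) :
    (qint (2 * k + 1) * qint (2 * k + 2)) • idp B 0 (2 * k + 2)
      = (B ^ 2 - qint (2 * k) ^ 2 • (1 : A)) * idp B 0 (2 * k) := by
  have h₁ : qint (2 * k + 1) ≠ 0 := qint_ne_zero (by omega)
  have h₂ : qint (2 * k + 2) ≠ 0 := qint_ne_zero (by omega)
  have t : (2 * k + 2 : ℤ).toNat = 2 * k + 1 + 1 := by omega
  have hf : qfact (2 * k + 1 + 1) = qfact (2 * k) * (qint (2 * k + 1) * qint (2 * k + 2)) := by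
    rw [qfact_succ, qfact_succ]
    push_cast
    rw [add_assoc _ (1 : ℤ) 1, mul_assoc, one_add_one_eq_two]
  rw [idp, if_neg (by omega), if_neg (by omega), if_pos rfl, if_pos (by omega), t, hf,
    show (2 * k + 1 + 1 + 1) / 2 - 1 = k by omega]
  rcases k with _ | k
  · simp only [Nat.cast_zero, mul_zero, zero_add] at h₁ h₂ ⊢
    simp [idp_zero, qfact, qint_zero, qint_one, smul_smul, h₂]
  · have t' : (2 * (k + 1 : ℕ) : ℤ).toNat = 2 * (k + 1) := by omega
    rw [idp, if_neg (by omega), if_neg (by omega), if_pos rfl, if_pos (by omega), t',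
      show (2 * (k + 1) + 1) / 2 - 1 = k by omega, mul_smul_comm]
    have := sq_sub_mul_prod_range B (fun r => qint (2 * (r + 1)) ^ 2) 2 k
    push_cast at this h₁ h₂ ⊢
    rw [this, smul_smul, mul_inv_rev, ← mul_assoc, mul_inv_cancel₀ (mul_ne_zero h₁ h₂), one_mul]

lemma idp_odd_add_two {A : Type*} [Ring A] [Algebra F A] (B : A) (k : ℕ) :
    (qint (2 * k + 2) * qint (2 * k + 3)) • idp B 1 (2 * k + 3)
      = (B ^ 2 - qint (2 * k + 1) ^ 2 • (1 : A)) * idp B 1 (2 * k + 1) := by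
  have h₁ : qint (2 * k + 2) ≠ 0 := qint_ne_zero (by omega)
  have h₂ : qint (2 * k + 3) ≠ 0 := qint_ne_zero (by omega)
  have t : (2 * k + 3 : ℤ).toNat = 2 * k + 1 + 1 + 1 := by omega
  have t' : (2 * k + 1 : ℤ).toNat = 2 * k + 1 := by omega
  have hf : qfact (2 * k + 1 + 1 + 1)
      = qfact (2 * k + 1) * (qint (2 * k + 2) * qint (2 * k + 3)) := by
    rw [qfact_succ, qfact_succ]
    push_cast
    rw [mul_assoc]
    congr 3
  rw [idp, if_neg (by omega), if_neg (by omega), if_neg one_ne_zero, if_neg (by omega), t, hf,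
    show (2 * k + 1 + 1 + 1) / 2 = k + 1 by omega]
  rw [idp, if_neg (by omega), if_neg (by omega), if_neg one_ne_zero, if_neg (by omega), t',
    show (2 * k + 1) / 2 = k by omega]
  have := sq_sub_mul_prod_range B (fun r => qint (2 * (r + 1) - 1) ^ 2) 1 k
  rw [show (2 * (k + 1) - 1 : ℤ) = 2 * k + 1 by ring] at this
  rw [mul_smul_comm, this, smul_smul, mul_inv_rev, ← mul_assoc,
    mul_inv_cancel₀ (mul_ne_zero h₁ h₂), one_mul]

/-- The recurrence for idivided powers whose degree has the parity of the index. -/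
lemma sq_mul_idp {A : Type*} [Ring A] [Algebra F A] (B : A) (n : ℕ) {m : ℤ}
    (h : (m - n) % 2 = 0) :
    B ^ 2 * idp B (n : ZMod 2) m
      = (qint (m + 1) * qint (m + 2)) • idp B (n : ZMod 2) (m + 2)
        + qint m ^ 2 • idp B (n : ZMod 2) m := by
  rcases lt_or_ge m 0 with hm | hm
  · have : (qint (m + 1) * qint (m + 2)) • idp B (n : ZMod 2) (m + 2) = 0 := by
      by_cases h₁ : m = -1
      · simp [h₁, qint_zero]
      by_cases h₂ : m = -2
      · simp [h₂, qint_zero]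
      rw [idp_of_neg B _ (by omega), smul_zero]
    rw [this, idp_of_neg B _ hm]
    simp
  obtain ⟨j, rfl⟩ := Int.eq_ofNat_of_zero_le hm
  rcases Nat.even_or_odd' j with ⟨k, rfl | rfl⟩
  · have hn : (n : ZMod 2) = 0 := by rw [ZMod.natCast_eq_zero_iff]; omega
    have := idp_even_add_two B k
    rw [hn]
    push_cast
    rw [this, sub_mul, smul_one_mul, sub_add_cancel]
  · have hn : (n : ZMod 2) = 1 := by
      rw [← Nat.cast_one, ZMod.natCast_eq_natCast_iff']; omega
    have := idp_odd_add_two B k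
    rw [hn]
    push_cast
    rw [show (2 * k + 1 + 1 : ℤ) = 2 * k + 2 by ring, show (2 * k + 1 + 2 : ℤ) = 2 * k + 3 by ring,
      this, sub_mul, smul_one_mul, sub_add_cancel]

/-- The vector `B^{(m)} v₀`. -/
def uz (n : ℕ) (m : ℤ) : V n := idp (Bop n) (n : ZMod 2) m (vz n 0)

lemma uz_of_neg (n : ℕ) {m : ℤ} (hm : m < 0) : uz n m = 0 := by
  rw [uz, idp_of_neg _ _ hm, LinearMap.zero_apply]

lemma Bop_sq_uz (n : ℕ) {m : ℤ} (h : (m - n) % 2 = 0) :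
    (Bop n ^ 2) (uz n m)
      = (qint (m + 1) * qint (m + 2)) • uz n (m + 2) + qint m ^ 2 • uz n m := by
  have := LinearMap.congr_fun (sq_mul_idp (Bop n) n h) (vz n 0)
  simpa [uz] using this

/-- The expansion of `v_{n-2l}`, with the summation range left free. -/
lemma vz_eq_sum (n l N : ℕ) (hN : n < 2 * l + 2 * N) :
    vz n (n - 2 * l) = ∑ c ∈ Finset.range N, coef l c • uz n (n - 2 * l - 2 * c) := by
  rcases lt_or_ge n (2 * l) with h | h
  · rw [vz_eq_zero (by omega)]
    exact (Finset.sum_eq_zero fun c _ => by rw [uz_of_neg n (by omega), smul_zero]).symm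
  obtain ⟨N, rfl⟩ : ∃ N', N = N' + 1 := ⟨N - 1, by omega⟩
  rcases lt_or_ge n (2 * l + 2) with h' | h'
  · rw [Finset.sum_range_succ', Finset.sum_eq_zero fun c _ => by
      rw [uz_of_neg n (by push_cast; omega), smul_zero]]
    rw [coef_zero, one_smul, zero_add, Nat.cast_zero, mul_zero, sub_zero]
    by_cases h₀ : n = 2 * l
    · rw [show (n - 2 * l : ℤ) = 0 by omega, uz, idp_zero, Module.End.one_apply]
    · have hn : (n : ZMod 2) = 1 := by
        rw [← Nat.cast_one, ZMod.natCast_eq_natCast_iff']; omega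
      rw [show (n - 2 * l : ℤ) = 1 by omega, uz, hn, idp_one_one, Bop_vz]
      rw [vz_eq_zero (k := 0 - 1) (by omega), zero_add, qint_one, one_smul, smul_zero, add_zero]
  have ih₁ := vz_eq_sum n (l + 1) (N + 1) (by omega)
  have ih₁' := vz_eq_sum n (l + 1) N (by omega)
  have ih₂ := vz_eq_sum n (l + 2) N (by omega)
  have hB := Bop_sq_vz n (n - 2 * (l + 1 : ℕ))
  set k : ℤ := n - 2 * (l + 1 : ℕ) with hk
  have ha : qint (k + 1) * qint (k + 2) ≠ 0 :=
    mul_ne_zero (qint_ne_zero (by omega)) (qint_ne_zero (by omega))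
  obtain ⟨D, hD, hD'⟩ : ∃ D : ℕ → F, D 0 = 0 ∧ ∀ c, D (c + 1) = coef (l + 2 : ℕ) c :=
    ⟨fun c => Nat.casesOn c 0 fun c => coef (l + 2 : ℕ) c, rfl, fun _ => rfl⟩
  have hX : uz n (k - 2 * N) = 0 := uz_of_neg n (by omega)
  have e₂ : vz n (k - 2) = ∑ c ∈ Finset.range N, D c • uz n (k - 2 * c) := by
    have : ∑ c ∈ Finset.range N, D c • uz n (k - 2 * c)
        = ∑ c ∈ Finset.range (N + 1), D c • uz n (k - 2 * c) := by
      rw [Finset.sum_range_succ, hX, smul_zero, add_zero]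
    rw [this, Finset.sum_range_succ', show (k - 2 : ℤ) = n - 2 * (l + 2 : ℕ) by omega, ih₂]
    simp only [hD, hD', zero_smul, add_zero]
    refine Finset.sum_congr rfl fun c _ => ?_
    congr 2
    omega
  have e₁ : (Bop n ^ 2) (vz n k)
      = ∑ c ∈ Finset.range N,
          (coef (l + 1 : ℕ) (c + 1) * (qint (k - 2 * c - 1) * qint (k - 2 * c))) • uz n (k - 2 * c)
        + (qint (k + 1) * qint (k + 2)) • uz n (k + 2)
        + ∑ c ∈ Finset.range N,
          (coef (l + 1 : ℕ) c * qint (k - 2 * c) ^ 2) • uz n (k - 2 * c) := by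
    have : ∀ c : ℕ, (Bop n ^ 2) (coef (l + 1 : ℕ) c • uz n (k - 2 * c))
        = (coef (l + 1 : ℕ) c * (qint (k - 2 * c + 1) * qint (k - 2 * c + 2)))
            • uz n (k - 2 * c + 2)
          + (coef (l + 1 : ℕ) c * qint (k - 2 * c) ^ 2) • uz n (k - 2 * c) := fun c => by
      rw [map_smul, Bop_sq_uz n (by omega), smul_add, smul_smul, smul_smul]
    rw [ih₁, map_sum]
    simp only [this]
    rw [Finset.sum_add_distrib, Finset.sum_range_succ', Finset.sum_range_succ (n := N), hX,
      smul_zero, add_zero, coef_zero, one_mul, Nat.cast_zero, mul_zero, sub_zero]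
    congr 2
    refine Finset.sum_congr rfl fun c _ => ?_
    push_cast
    rw [show k - 2 * ((c : ℤ) + 1) + 1 = k - 2 * c - 1 by ring,
      show k - 2 * ((c : ℤ) + 1) + 2 = k - 2 * c by ring]
  have e₀ : ∑ c ∈ Finset.range (N + 1), coef l c • uz n (n - 2 * l - 2 * c)
      = ∑ c ∈ Finset.range N, coef l (c + 1) • uz n (k - 2 * c) + uz n (k + 2) := by
    rw [Finset.sum_range_succ', coef_zero, one_smul]
    congr 1
    · refine Finset.sum_congr rfl fun c _ => ?_
      congr 2
      omega
    · congr 1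
      omega
  rw [e₀]
  refine smul_right_injective _ ha ?_
  simp only
  rw [e₁, ih₁', e₂] at hB
  rw [show (n - 2 * l : ℤ) = k + 2 by omega, smul_add]
  have hsum : ∑ c ∈ Finset.range N,
          (coef (l + 1 : ℕ) (c + 1) * (qint (k - 2 * c - 1) * qint (k - 2 * c))) • uz n (k - 2 * c)
        + ∑ c ∈ Finset.range N,
          (coef (l + 1 : ℕ) c * qint (k - 2 * c) ^ 2) • uz n (k - 2 * c)
      = (qint (k + 1) * qint (k + 2)) • ∑ c ∈ Finset.range N, coef l (c + 1) • uz n (k - 2 * c)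
        + (qint (k + 1) * qz (2 * k - n + 1) * qint (n - k)
          + qz (2 * k - n - 1) * qint (n + 1 - k) * qint k)
          • ∑ c ∈ Finset.range N, coef (l + 1 : ℕ) c • uz n (k - 2 * c)
        + (qz (2 * k - n - 1) * qint (n + 1 - k) * qz (2 * k - n - 3) * qint (n + 2 - k))
          • ∑ c ∈ Finset.range N, D c • uz n (k - 2 * c) := by
    simp only [Finset.smul_sum, smul_smul]
    simp only [← Finset.sum_add_distrib, ← add_smul]
    refine Finset.sum_congr rfl fun c _ => ?_
    congr 1
    have h₁ := coef_succ_mul (l + 1 : ℕ) c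
    have h₂ := coef_pred_succ_mul (l + 1 : ℕ) c
    have h₃ : D c * qbr ((l + 1 : ℕ) + 1)
        = -qz (2 * (l + 1 : ℕ) - 2 * c + 3) * qbr c * coef (l + 1 : ℕ) c := by
      cases c with
      | zero => simp [hD, qbr]
      | succ c => rw [hD']; exact coef_succ_pred_mul (l + 1 : ℕ) c
    have key := coef_identity n (l + 1 : ℕ) c (by omega) (by omega) _ _ _ _ h₁ h₂ h₃
    rw [← hk, show ((l + 1 : ℕ) : ℤ) - 1 = l by omega] at key
    rw [show 2 * k - n + 1 = n - 4 * (l + 1 : ℕ) + 1 by omega,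
      show 2 * k - n - 1 = n - 4 * (l + 1 : ℕ) - 1 by omega,
      show 2 * k - n - 3 = n - 4 * (l + 1 : ℕ) - 3 by omega,
      show n - k = 2 * (l + 1 : ℕ) by omega,
      show n + 1 - k = 2 * (l + 1 : ℕ) + 1 by omega,
      show n + 2 - k = 2 * (l + 1 : ℕ) + 2 by omega, ← key]
    ring
  linear_combination (exp := 1) hsum - hB
termination_by n - 2 * l

end Lnmod

/-- Proposition 3.9 (`prop:inverse`, even case) of the paper: on `L(n)`, with `p = n mod 2`,
for `0 ≤ 2ℓ ≤ n`:
`v_{n−2ℓ} = Σ_{c=0}^{⌊n/2⌋−ℓ} (−1)^c q^{−(2ℓ+1)c} ⌊ℓ+c ¦ c⌋_{q²} · B^{(n−2ℓ−2c)}_{p̄}(v₀)`. -/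
theorem statement10 (n : ℕ) (l : ℕ) (hl : 2 * l ≤ n) :
    vb n ⟨n - 2 * l, by omega⟩
      = ∑ c ∈ Finset.range (n / 2 - l + 1),
          ((-1 : F) ^ c * qz (-((2 * (l : ℤ) + 1) * c)) * qbinom2 ((l : ℤ) + c) c) •
            (idp (Bop n) ((n : ℕ) : ZMod 2) ((n : ℤ) - 2 * l - 2 * c)) (vb n 0) := by
  have h := vz_eq_sum n l (n / 2 - l + 1) (by omega)
  have e : (n - 2 * l : ℤ) = ((n - 2 * l : ℕ) : ℤ) := by omega
  have e₀ : vz n 0 = vb n 0 := vz_natCast n 0 (by omega)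
  rw [← vz_natCast, ← e, h]
  simp only [uz, coef, e₀]
end
end
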